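/- arXiv:2105.04156 — 8 statements merged into one kernel-verified Lean document; each statement's English description precedes it below -/
import Mathlib

section
/- For every integer ℓ ≥ 1 and every real number x, the ℓ-fold composition g_ℓ(x) equals the sum of the hat basis functions at the odd nodes of level ℓ: g_ℓ(x) = Σ_{i odd, 1 ≤ i ≤ 2^ℓ − 1} φ_{ℓ,i}(x), where φ_{ℓ,i}(x) = g((x − (i − 1)·2^{−ℓ}) / (2·2^{−ℓ})). -/
/-- The hat function `g`. -/
noncomputable def hatg (x : ℝ) : ℝ :=
  if 0 ≤ x ∧ x ≤ 1/2 then 2*x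
  else if 1/2 < x ∧ x ≤ 1 then 2*(1-x)
  else 0

/-- The nodal basis function `φ_{ℓ,i}` on the uniform grid of `[0,1]`
with mesh size `h_ℓ = 2^{-ℓ}`. -/
noncomputable def phiNodal (ℓ : ℕ) (i : ℕ) (x : ℝ) : ℝ :=
  hatg ((x - ((i : ℝ) - 1) * (2:ℝ)^(-(ℓ:ℤ))) / (2 * (2:ℝ)^(-(ℓ:ℤ))))

theorem hatg_of_nonpos {x : ℝ} (hx : x ≤ 0) : hatg x = 0 := by
  unfold hatg
  split_ifs <;> linarith

theorem hatg_of_one_le {x : ℝ} (hx : 1 ≤ x) : hatg x = 0 := by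
  unfold hatg
  split_ifs <;> linarith

theorem hatg_one_sub (x : ℝ) : hatg (1 - x) = hatg x := by
  unfold hatg
  split_ifs <;> grind

/-- Composing a translated dilate of `hatg` with `hatg` produces two translated dilates. -/
theorem hatg_mul_hatg_sub {N k : ℝ} (hk : 0 ≤ k) (hkN : k + 1 ≤ N) (x : ℝ) :
    hatg (N * hatg x - k) = hatg (2 * N * x - k) + hatg (2 * N * x - (2 * N - 1 - k)) := by
  have hN : 0 ≤ N := by linarith
  rw [← hatg_one_sub (2 * N * x - (2 * N - 1 - k))]
  rcases le_or_gt x 0 with h0 | h0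
  · rw [hatg_of_nonpos h0, hatg_of_nonpos (x := N * 0 - k) (by linarith),
      hatg_of_nonpos (x := 2 * N * x - k) (by nlinarith), hatg_of_one_le (by nlinarith), add_zero]
  rcases le_or_gt 1 x with h1 | h1
  · rw [hatg_of_one_le h1, hatg_of_nonpos (x := N * 0 - k) (by linarith),
      hatg_of_one_le (x := 2 * N * x - k) (by nlinarith), hatg_of_nonpos (by nlinarith), add_zero]
  rcases le_or_gt x (1 / 2) with h2 | h2
  · have hx : hatg x = 2 * x := by simp only [hatg, if_pos (And.intro h0.le h2)]
    rw [hx, hatg_of_one_le (x := 1 - _) (by nlinarith), add_zero]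
    ring_nf
  · have hx : hatg x = 2 * (1 - x) := by
      unfold hatg
      split_ifs <;> grind
    rw [hx, hatg_of_one_le (x := 2 * N * x - k) (by nlinarith), zero_add]
    ring_nf

theorem sum_range_two_mul_reflect {M : Type*} [AddCommMonoid M] (f : ℕ → M) (n : ℕ) :
    ∑ k ∈ Finset.range (2 * n), f k = ∑ k ∈ Finset.range n, (f k + f (2 * n - 1 - k)) := by
  rw [two_mul, Finset.sum_range_add, Finset.sum_add_distrib,
    ← Finset.sum_range_reflect (fun k => f (n + k))]
  congr 1
  refine Finset.sum_congr rfl fun k hk => congrArg f ?_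
  have := Finset.mem_range.mp hk
  omega

theorem sum_range_two_mul_ite_odd {M : Type*} [AddCommMonoid M] (f : ℕ → M) (n : ℕ) :
    (∑ i ∈ Finset.range (2 * n), if Odd i then f i else 0) =
      ∑ k ∈ Finset.range n, f (2 * k + 1) := by
  induction n with
  | zero => simp
  | succ n ih =>
    rw [mul_add, mul_one, Finset.sum_range_succ, Finset.sum_range_succ, ih,
      Finset.sum_range_succ]
    simp [← Nat.not_even_iff_odd]

theorem hatg_iterate_succ (m : ℕ) (x : ℝ) :
    hatg^[m + 1] x = ∑ k ∈ Finset.range (2 ^ m), hatg (2 ^ m * x - k) := by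
  induction m generalizing x with
  | zero => simp
  | succ m ih =>
    rw [Function.iterate_succ_apply, ih, pow_succ' 2 m, sum_range_two_mul_reflect]
    refine Finset.sum_congr rfl fun k hk => ?_
    have hk' : k + 1 ≤ 2 ^ m := Finset.mem_range.mp hk
    have hcast : ((2 * 2 ^ m - 1 - k : ℕ) : ℝ) = 2 * 2 ^ m - 1 - k := by
      rw [Nat.cast_sub (by omega), Nat.cast_sub (by omega)]
      push_cast
      ring
    rw [hatg_mul_hatg_sub k.cast_nonneg (by exact_mod_cast hk'), hcast, pow_succ' 2 m]

theorem phiNodal_succ_odd (m k : ℕ) (x : ℝ) :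
    phiNodal (m + 1) (2 * k + 1) x = hatg (2 ^ m * x - k) := by
  unfold phiNodal
  congr 1
  rw [zpow_neg, zpow_natCast, pow_succ]
  push_cast
  field_simp
  ring

theorem stmt1 (ℓ : ℕ) (hℓ : 1 ≤ ℓ) (x : ℝ) :
    hatg^[ℓ] x = ∑ i ∈ Finset.range (2^ℓ), if Odd i then phiNodal ℓ i x else 0 := by
  obtain ⟨m, rfl⟩ := Nat.exists_eq_add_of_le' hℓ
  rw [hatg_iterate_succ, pow_succ' 2 m, sum_range_two_mul_ite_odd]
  exact Finset.sum_congr rfl fun k _ => (phiNodal_succ_odd m k x).symm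
end

section
/- For every integer L ≥ 1, every integer i with 0 ≤ i ≤ 2^L − 1, and every x ∈ [i·2^{−L}, (i+1)·2^{−L}], one has x − Σ_{ℓ=1}^{L} 2^{−2ℓ} g_ℓ(x) = (2i+1)·2^{−L}·x − i(i+1)·2^{−2L}. In other words, the function x − Σ_{ℓ=1}^{L} 2^{−2ℓ} g_ℓ(x) coincides on [0,1] with the piecewise linear interpolant I_L s of s(x) = x² at the nodes i·2^{−L}, 0 ≤ i ≤ 2^L. -/
theorem hatg_of_le_half {x : ℝ} (h0 : 0 ≤ x) (h1 : x ≤ 1/2) : hatg x = 2*x :=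
  if_pos ⟨h0, h1⟩

theorem hatg_of_half_le {x : ℝ} (h0 : 1/2 ≤ x) (h1 : x ≤ 1) : hatg x = 2*(1-x) := by
  unfold hatg
  split_ifs <;> grind

theorem sum_hatg_iterate_succ (L : ℕ) (x : ℝ) :
    ∑ ℓ ∈ Finset.range (L+1), hatg^[ℓ+1] x / 4^(ℓ+1)
      = hatg x / 4 + (∑ ℓ ∈ Finset.range L, hatg^[ℓ+1] (hatg x) / 4^(ℓ+1)) / 4 := by
  rw [Finset.sum_range_succ', add_comm, Finset.sum_div]
  congr 1
  · simp
  · refine Finset.sum_congr rfl fun ℓ _ => ?_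
    rw [Function.iterate_succ_apply, pow_succ _ (ℓ+1), div_div]

/-- The identity of `stmt2`, with denominators cleared and the trivial level `L = 0` included. -/
theorem sub_sum_hatg_iterate (L i : ℕ) (hi : i < 2^L) (x : ℝ)
    (h0 : (i:ℝ) ≤ x * 2^L) (h1 : x * 2^L ≤ i + 1) :
    x - ∑ ℓ ∈ Finset.range L, hatg^[ℓ+1] x / 4^(ℓ+1)
      = ((2*i+1) * 2^L * x - i*(i+1)) / 4^L := by
  induction L generalizing i x with
  | zero =>
    obtain rfl : i = 0 := by simpa using hi
    simp
  | succ L ih =>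
    have hN : (0:ℝ) < 2^L := by positivity
    have h4 : (4:ℝ)^L = 2^L * 2^L := by rw [← mul_pow]; norm_num
    rw [sum_hatg_iterate_succ, pow_succ (4:ℝ), h4]
    rw [pow_succ] at h0 h1 hi ⊢
    rcases lt_or_ge i (2^L) with hlt | hge
    · have hle : (i:ℝ) + 1 ≤ 2^L := by exact_mod_cast hlt
      have hx0 : 0 ≤ x := by
        by_contra! h
        nlinarith [mul_pos_of_neg_of_neg h (neg_neg_of_pos hN), Nat.cast_nonneg (α := ℝ) i]
      have hx1 : x ≤ 1/2 := by
        by_contra! h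
        nlinarith
      have hF := ih i hlt (2*x) (by linarith) (by linarith)
      rw [h4, sub_eq_iff_eq_add, ← sub_eq_iff_eq_add'] at hF
      rw [hatg_of_le_half hx0 hx1, ← hF]
      field_simp
      ring
    · obtain ⟨j, hj⟩ : ∃ j, i + j + 1 = 2^L * 2 := ⟨2^L * 2 - 1 - i, by omega⟩
      have hjlt : j < 2^L := by omega
      have hij : (i:ℝ) = 2^L * 2 - 1 - j := by
        have : (i:ℝ) + j + 1 = 2^L * 2 := by exact_mod_cast hj
        linarith
      have hle : (2:ℝ)^L ≤ i := by exact_mod_cast hge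
      have hx0 : 1/2 ≤ x := by
        by_contra! h
        nlinarith
      have hx1 : x ≤ 1 := by
        by_contra! h
        nlinarith [Nat.cast_nonneg (α := ℝ) j]
      have hF := ih j hjlt (2*(1-x)) (by linarith) (by linarith)
      rw [h4, sub_eq_iff_eq_add, ← sub_eq_iff_eq_add'] at hF
      rw [hatg_of_half_le hx0 hx1, hij, ← hF]
      field_simp
      ring

theorem stmt2 (L : ℕ) (hL : 1 ≤ L) (i : ℕ) (hi : i < 2^L) (x : ℝ)
    (hx : x ∈ Set.Icc ((i:ℝ) * (2:ℝ)^(-(L:ℤ))) (((i:ℝ) + 1) * (2:ℝ)^(-(L:ℤ)))) :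
    x - ∑ ℓ ∈ Finset.Icc 1 L, (2:ℝ)^(-(2*(ℓ:ℤ))) * hatg^[ℓ] x
      = (2*(i:ℝ) + 1) * (2:ℝ)^(-(L:ℤ)) * x - (i:ℝ) * ((i:ℝ) + 1) * (2:ℝ)^(-(2*(L:ℤ))) := by
  have hpow (n : ℕ) : (2:ℝ)^(-(2*(n:ℤ))) = (4^n)⁻¹ := by
    rw [zpow_neg, zpow_mul, zpow_natCast]
    norm_num
  have hN : (0:ℝ) < 2^L := by positivity
  have h4 : (4:ℝ)^L = 2^L * 2^L := by rw [← mul_pow]; norm_num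
  simp only [hpow, zpow_neg, zpow_natCast] at hx ⊢
  have h := sub_sum_hatg_iterate L i hi x
    ((mul_inv_le_iff₀ hN).mp hx.1) ((le_mul_inv_iff₀ hN).mp hx.2)
  have hsum : ∑ ℓ ∈ Finset.Icc 1 L, ((4:ℝ)^ℓ)⁻¹ * hatg^[ℓ] x
      = ∑ ℓ ∈ Finset.range L, hatg^[ℓ+1] x / 4^(ℓ+1) := by
    rw [Finset.range_eq_Ico, Finset.sum_Ico_add' (fun ℓ => hatg^[ℓ] x / 4^ℓ) 0 L 1]
    exact Finset.sum_congr rfl fun ℓ _ => by ring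
  rw [hsum, h, h4]
  field_simp
end

section
/- For every integer L ≥ 0, let S_L(x) = x − Σ_{ℓ=1}^{L} 2^{−2ℓ} g_ℓ(x) (the piecewise linear interpolant of x² on [0,1] with mesh size 2^{−L}; the sum is empty for L = 0). Then sup_{x ∈ [0,1]} |x² − S_L(x)| = 2^{−2(L+1)}, and the function x ↦ x² − S_L(x) is Lipschitz on [0,1] with Lipschitz constant at most 2^{−L}, i.e., |(x² − S_L(x)) − (y² − S_L(y))| ≤ 2^{−L}|x − y| for all x, y ∈ [0,1]. -/
/-- `S_L(x) = x − Σ_{ℓ=1}^{L} 2^{−2ℓ} g_ℓ(x)`, the piecewise linear interpolant of `x²`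
on `[0,1]` with mesh size `2^{−L}`. -/
noncomputable def SL (L : ℕ) (x : ℝ) : ℝ :=
  x - ∑ ℓ ∈ Finset.Icc 1 L, (2:ℝ)^(-(2*(ℓ:ℤ))) * hatg^[ℓ] x

theorem hatg_mem_Icc {x : ℝ} (hx : x ∈ Set.Icc (0 : ℝ) 1) : hatg x ∈ Set.Icc (0 : ℝ) 1 := by
  obtain ⟨h0, h1⟩ := hx
  unfold hatg
  split_ifs <;> constructor <;> linarith

theorem hatg_iterate_mem_Icc (n : ℕ) {x : ℝ} (hx : x ∈ Set.Icc (0 : ℝ) 1) :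
    hatg^[n] x ∈ Set.Icc (0 : ℝ) 1 :=
  Set.MapsTo.iterate (fun _ h => hatg_mem_Icc h) n hx

theorem hatg_eq_one_sub_abs {x : ℝ} (hx : x ∈ Set.Icc (0 : ℝ) 1) :
    hatg x = 1 - |2 * x - 1| := by
  obtain ⟨h0, h1⟩ := hx
  unfold hatg
  rcases le_or_gt x (1 / 2) with h | h
  · rw [if_pos ⟨h0, h⟩, abs_of_nonpos (by linarith)]
    ring
  · rw [if_neg (fun h' => h.not_ge h'.2), if_pos ⟨h, h1⟩, abs_of_pos (by linarith)]
    ring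

theorem hatg_sq_sub_self {x : ℝ} (hx : x ∈ Set.Icc (0 : ℝ) 1) :
    hatg x ^ 2 - hatg x = 4 * (x ^ 2 - x) + hatg x := by
  rw [hatg_eq_one_sub_abs hx]
  linear_combination sq_abs (2 * x - 1)

theorem abs_hatg_sub_hatg_le {x y : ℝ} (hx : x ∈ Set.Icc (0 : ℝ) 1)
    (hy : y ∈ Set.Icc (0 : ℝ) 1) : |hatg x - hatg y| ≤ 2 * |x - y| := by
  rw [hatg_eq_one_sub_abs hx, hatg_eq_one_sub_abs hy]
  calc |1 - |2 * x - 1| - (1 - |2 * y - 1|)| = |(|2 * y - 1| - |2 * x - 1|)| := by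
        congr 1; ring
    _ ≤ |(2 * y - 1) - (2 * x - 1)| := abs_abs_sub_abs_le_abs_sub _ _
    _ = |2 * (y - x)| := by congr 1; ring
    _ = 2 * |x - y| := by rw [abs_mul, abs_two, abs_sub_comm]

theorem abs_hatg_iterate_sub_le (n : ℕ) {x y : ℝ} (hx : x ∈ Set.Icc (0 : ℝ) 1)
    (hy : y ∈ Set.Icc (0 : ℝ) 1) : |hatg^[n] x - hatg^[n] y| ≤ 2 ^ n * |x - y| := by
  induction n with
  | zero => simp
  | succ n ih =>
    rw [Function.iterate_succ_apply', Function.iterate_succ_apply']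
    have h := abs_hatg_sub_hatg_le (hatg_iterate_mem_Icc n hx) (hatg_iterate_mem_Icc n hy)
    rw [pow_succ]
    linarith

theorem hatg_iterate_inv_two_pow (n : ℕ) : hatg^[n] ((1 / 2 : ℝ) ^ (n + 1)) = 1 / 2 := by
  induction n with
  | zero => simp
  | succ n ih =>
    have hle : (1 / 2 : ℝ) ^ (n + 1) ≤ 1 := pow_le_one₀ (by norm_num) (by norm_num)
    have hstep : hatg ((1 / 2 : ℝ) ^ (n + 1 + 1)) = (1 / 2) ^ (n + 1) := by
      rw [hatg, if_pos ⟨by positivity, by rw [pow_succ]; linarith⟩, pow_succ _ (n + 1)]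
      ring
    rw [Function.iterate_succ_apply, hstep, ih]

theorem two_zpow_neg_two_mul (n : ℕ) : (2 : ℝ) ^ (-(2 * (n : ℤ))) = (1 / 4) ^ n := by
  rw [zpow_neg, zpow_mul, zpow_natCast, one_div, inv_pow]
  norm_num

/-- The interpolation error is a rescaled copy of `u ^ 2 - u` evaluated at the iterated hat. -/
theorem sq_sub_SL (L : ℕ) {x : ℝ} (hx : x ∈ Set.Icc (0 : ℝ) 1) :
    x ^ 2 - SL L x = (1 / 4) ^ L * ((hatg^[L] x) ^ 2 - hatg^[L] x) := by
  induction L with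
  | zero => simp [SL]
  | succ L ih =>
    have hSL : SL (L + 1) x = SL L x - (1 / 4) ^ (L + 1) * hatg^[L + 1] x := by
      rw [SL, SL, Finset.sum_Icc_succ_top (by omega), two_zpow_neg_two_mul]
      ring
    rw [hSL, Function.iterate_succ_apply', pow_succ]
    linear_combination ih - (1 / 4) ^ L * (1 / 4) * hatg_sq_sub_self (hatg_iterate_mem_Icc L hx)

theorem stmt3 (L : ℕ) :
    ((∀ x ∈ Set.Icc (0:ℝ) 1, |x^2 - SL L x| ≤ (2:ℝ)^(-(2*((L:ℤ)+1)))) ∧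
      (∃ x ∈ Set.Icc (0:ℝ) 1, |x^2 - SL L x| = (2:ℝ)^(-(2*((L:ℤ)+1))))) ∧
    (∀ x ∈ Set.Icc (0:ℝ) 1, ∀ y ∈ Set.Icc (0:ℝ) 1,
      |(x^2 - SL L x) - (y^2 - SL L y)| ≤ (2:ℝ)^(-(L:ℤ)) * |x - y|) := by
  have hexp : (2 : ℝ) ^ (-(2 * ((L : ℤ) + 1))) = (1 / 4) ^ L * (1 / 4) := by
    have h := two_zpow_neg_two_mul (L + 1)
    rw [pow_succ] at h
    exact_mod_cast h
  have hpos : (0 : ℝ) < (1 / 4) ^ L := by positivity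
  refine ⟨⟨fun x hx => ?_, (1 / 2) ^ (L + 1), ?_, ?_⟩, fun x hx y hy => ?_⟩
  · rw [sq_sub_SL L hx, hexp, abs_mul, abs_of_pos hpos]
    obtain ⟨h0, h1⟩ := hatg_iterate_mem_Icc L hx
    refine mul_le_mul_of_nonneg_left (abs_le.mpr ⟨?_, ?_⟩) hpos.le
    · nlinarith [sq_nonneg (hatg^[L] x - 1 / 2)]
    · nlinarith
  · exact ⟨by positivity, pow_le_one₀ (by norm_num) (by norm_num)⟩
  · rw [sq_sub_SL L ⟨by positivity, pow_le_one₀ (by norm_num) (by norm_num)⟩,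
      hatg_iterate_inv_two_pow, hexp, abs_mul, abs_of_pos hpos]
    norm_num
  · rw [sq_sub_SL L hx, sq_sub_SL L hy]
    obtain ⟨hu0, hu1⟩ := hatg_iterate_mem_Icc L hx
    obtain ⟨hv0, hv1⟩ := hatg_iterate_mem_Icc L hy
    have hlip := abs_hatg_iterate_sub_le L hx hy
    set u := hatg^[L] x
    set v := hatg^[L] y
    have hscale : (1 / 4 : ℝ) ^ L * 2 ^ L = 2 ^ (-(L : ℤ)) := by
      rw [← mul_pow, zpow_neg, zpow_natCast, ← inv_pow]
      norm_num
    calc |(1 / 4) ^ L * (u ^ 2 - u) - (1 / 4) ^ L * (v ^ 2 - v)|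
        = (1 / 4) ^ L * (|u + v - 1| * |u - v|) := by
          rw [← abs_mul, ← abs_of_pos hpos, ← abs_mul, abs_of_pos hpos]
          congr 1
          ring
      _ ≤ (1 / 4) ^ L * (1 * (2 ^ L * |x - y|)) := by
          gcongr
          exact abs_le.mpr ⟨by linarith, by linarith⟩
      _ = 2 ^ (-(L : ℤ)) * |x - y| := by rw [← hscale]; ring
end

section
/- Define ReLU1 : ℝ → ℝ by ReLU1(x) = ReLU(x) − ReLU(x − 1), and define Φ : ℝ² → ℝ by Φ(x, y) = (1/2)·(g_2(ReLU1(x)/2) + g_2(ReLU1(y)/2) − g_2((ReLU1(x) + ReLU1(y))/2)), where g_2 = g ∘ g. Then for all (x, y) ∈ ℝ²: if (x, y) ∈ [0,1]² then Φ(x, y) = (1/2)·(g_2(x/2) + g_2(y/2) − g_2((x+y)/2)), and if (x, y) ∉ [0,1]² then Φ(x, y) = 0. That is, Φ equals the linear finite element hat basis function φ supported in [0,1]², globally on all of ℝ². -/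
noncomputable def ReLU (x : ℝ) : ℝ := max 0 x

/-- `ReLU1(x) = ReLU(x) − ReLU(x−1)`. -/
noncomputable def ReLU1 (x : ℝ) : ℝ := ReLU x - ReLU (x - 1)

/-- `Φ(x,y) = (1/2)(g₂(ReLU1(x)/2) + g₂(ReLU1(y)/2) − g₂((ReLU1(x)+ReLU1(y))/2))`
where `g₂ = g ∘ g`. -/
noncomputable def Phi (x y : ℝ) : ℝ :=
  (1/2) * (hatg (hatg (ReLU1 x / 2)) + hatg (hatg (ReLU1 y / 2))
    - hatg (hatg ((ReLU1 x + ReLU1 y) / 2)))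

theorem ReLU1_of_nonpos {x : ℝ} (hx : x ≤ 0) : ReLU1 x = 0 := by
  simp [ReLU1, ReLU, max_eq_left hx, max_eq_left (show x - 1 ≤ 0 by linarith)]

theorem ReLU1_of_one_le {x : ℝ} (hx : 1 ≤ x) : ReLU1 x = 1 := by
  simp [ReLU1, ReLU, max_eq_right (show 0 ≤ x by linarith),
    max_eq_right (show 0 ≤ x - 1 by linarith)]

theorem ReLU1_of_mem_Icc {x : ℝ} (hx : x ∈ Set.Icc (0 : ℝ) 1) : ReLU1 x = x := by
  simp [ReLU1, ReLU, max_eq_right hx.1, max_eq_left (show x - 1 ≤ 0 by linarith [hx.2])]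

theorem ReLU1_mem_Icc (x : ℝ) : ReLU1 x ∈ Set.Icc (0 : ℝ) 1 := by
  rcases le_total x 0 with h | h
  · simp [ReLU1_of_nonpos h]
  · rcases le_total x 1 with h' | h'
    · rw [ReLU1_of_mem_Icc ⟨h, h'⟩]
      exact ⟨h, h'⟩
    · simp [ReLU1_of_one_le h']

theorem ReLU1_eq_zero_or_one_of_notMem {x : ℝ} (hx : x ∉ Set.Icc (0 : ℝ) 1) :
    ReLU1 x = 0 ∨ ReLU1 x = 1 := by
  rcases le_total x 0 with h | h
  · exact .inl (ReLU1_of_nonpos h)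
  · rcases le_total x 1 with h' | h'
    · exact absurd ⟨h, h'⟩ hx
    · exact .inr (ReLU1_of_one_le h')

theorem hatg_half {x : ℝ} (hx : x ∈ Set.Icc (0 : ℝ) 1) : hatg (x / 2) = x := by
  rw [hatg, if_pos ⟨by linarith [hx.1], by linarith [hx.2]⟩]
  ring

/-- On `[0, 1]` the iterate `g ∘ g` is periodic with period `1/2`. -/
theorem hatg_hatg_one_add_half {x : ℝ} (hx : x ∈ Set.Icc (0 : ℝ) 1) :
    hatg (hatg ((1 + x) / 2)) = hatg (hatg (x / 2)) := by
  have h : (1 + x) / 2 = 1 - (1 - x) / 2 := by ring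
  rw [h, hatg_one_sub, hatg_half ⟨by linarith [hx.2], by linarith [hx.1]⟩, hatg_one_sub,
    hatg_half hx]

theorem hatg_zero : hatg 0 = 0 := by norm_num [hatg]

theorem hatg_hatg_half_of_eq_zero_or_one {u : ℝ} (hu : u = 0 ∨ u = 1) :
    hatg (hatg (u / 2)) = 0 := by
  rcases hu with rfl | rfl
  · simp [hatg_zero]
  · rw [hatg_half (by simp), ← hatg_one_sub, sub_self, hatg_zero]

theorem hatg_hatg_add_half_of_eq_zero_or_one {u v : ℝ} (hu : u = 0 ∨ u = 1)
    (hv : v ∈ Set.Icc (0 : ℝ) 1) : hatg (hatg ((u + v) / 2)) = hatg (hatg (v / 2)) := by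
  rcases hu with rfl | rfl
  · rw [zero_add]
  · exact hatg_hatg_one_add_half hv

theorem Phi_comm (x y : ℝ) : Phi x y = Phi y x := by
  rw [Phi, Phi, add_comm (ReLU1 x), add_comm (hatg (hatg (ReLU1 x / 2)))]

theorem Phi_eq_zero_of_notMem_left {x : ℝ} (hx : x ∉ Set.Icc (0 : ℝ) 1) (y : ℝ) :
    Phi x y = 0 := by
  have hu := ReLU1_eq_zero_or_one_of_notMem hx
  rw [Phi, hatg_hatg_half_of_eq_zero_or_one hu,
    hatg_hatg_add_half_of_eq_zero_or_one hu (ReLU1_mem_Icc y)]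
  ring

theorem stmt14 (x y : ℝ) :
    (x ∈ Set.Icc (0:ℝ) 1 ∧ y ∈ Set.Icc (0:ℝ) 1 →
      Phi x y = (1/2) * (hatg (hatg (x/2)) + hatg (hatg (y/2)) - hatg (hatg ((x+y)/2)))) ∧
    (¬(x ∈ Set.Icc (0:ℝ) 1 ∧ y ∈ Set.Icc (0:ℝ) 1) → Phi x y = 0) := by
  refine ⟨fun ⟨hx, hy⟩ => by rw [Phi, ReLU1_of_mem_Icc hx, ReLU1_of_mem_Icc hy], fun h => ?_⟩
  rcases not_and_or.mp h with hx | hy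
  · exact Phi_eq_zero_of_notMem_left hx y
  · rw [Phi_comm, Phi_eq_zero_of_notMem_left hy]
end

section
/- For every real number x, g(g(x)) = 4·ReLU(x) − 8·ReLU(x − 1/4) + 8·ReLU(x − 1/2) − 8·ReLU(x − 3/4) + 4·ReLU(x − 1). -/
theorem stmt15 (x : ℝ) :
    hatg (hatg x) = 4 * ReLU x - 8 * ReLU (x - 1/4) + 8 * ReLU (x - 1/2)
      - 8 * ReLU (x - 3/4) + 4 * ReLU (x - 1) := by
  simp only [ReLU, max_def, hatg]
  grind
end

section
/- For every input dimension d ≥ 1 and all integers L ≥ 1 and N ≥ 1, the ResNet-type class is contained in the standard class with enlarged width: 𝒩̂_L^N ⊆ 𝒩_L^{N + 2(d+1)}, i.e., every function f : ℝ^d → ℝ realizable in 𝒩̂_L^N is realizable as a standard ReLU network with L hidden layers of width N + 2(d+1). -/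
/-- Hidden-layer outputs of a standard ReLU network: `stdLayer … ℓ x` is the output of the
`(ℓ+1)`-st hidden layer (all hidden layers have width `N`); `σ = ReLU` is applied
componentwise after each affine map. -/
noncomputable def stdLayer (d N : ℕ) (W1 : Fin N → Fin d → ℝ) (b1 : Fin N → ℝ)
    (W : ℕ → Fin N → Fin N → ℝ) (b : ℕ → Fin N → ℝ) :
    ℕ → (Fin d → ℝ) → Fin N → ℝ
  | 0, x, i => max 0 (∑ j, W1 i j * x j + b1 i)
  | (ℓ+1), x, i => max 0 (∑ j, W ℓ i j * stdLayer d N W1 b1 W b ℓ x j + b ℓ i)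

/-- `𝒩_L^N` (input dimension `d`): functions realized by a standard ReLU network with
`L` hidden layers of width `N`, followed by a final affine map to `ℝ`. -/
noncomputable def stdNet (d N L : ℕ) : Set ((Fin d → ℝ) → ℝ) :=
  { f | ∃ (W1 : Fin N → Fin d → ℝ) (b1 : Fin N → ℝ)
      (W : ℕ → Fin N → Fin N → ℝ) (b : ℕ → Fin N → ℝ)
      (wout : Fin N → ℝ) (bout : ℝ),
      ∀ x, f x = ∑ j, wout j * stdLayer d N W1 b1 W b (L - 1) x j + bout }

/-- Hidden-layer outputs of the ResNet-type ReLU network of the paper: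
`resLayer … ℓ x` is `f^{ℓ+1}(x)`, where `f^1(x) = σ(θ̂^1 x)` and
`f^{ℓ+1}(x) = σ(θ̂^{ℓ+1}([x, f^ℓ(x)]))`, each `θ̂` affine. -/
noncomputable def resLayer (d N : ℕ) (W1 : Fin N → Fin d → ℝ) (b1 : Fin N → ℝ)
    (Wx : ℕ → Fin N → Fin d → ℝ) (Wf : ℕ → Fin N → Fin N → ℝ) (b : ℕ → Fin N → ℝ) :
    ℕ → (Fin d → ℝ) → Fin N → ℝ
  | 0, x, i => max 0 (∑ j, W1 i j * x j + b1 i)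
  | (ℓ+1), x, i => max 0 ((∑ j, Wx ℓ i j * x j)
      + (∑ j, Wf ℓ i j * resLayer d N W1 b1 Wx Wf b ℓ x j) + b ℓ i)

/-- `𝒩̂_L^N` (input dimension `d`): the ResNet-type class, where the final affine map
`θ̂^{L+1} : ℝ^{d+LN} → ℝ` is applied to `[x, f^1(x), …, f^L(x)]`. -/
noncomputable def resNet (d N L : ℕ) : Set ((Fin d → ℝ) → ℝ) :=
  { f | ∃ (W1 : Fin N → Fin d → ℝ) (b1 : Fin N → ℝ)
      (Wx : ℕ → Fin N → Fin d → ℝ) (Wf : ℕ → Fin N → Fin N → ℝ) (b : ℕ → Fin N → ℝ)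
      (wx : Fin d → ℝ) (wf : ℕ → Fin N → ℝ) (bout : ℝ),
      ∀ x, f x = (∑ j, wx j * x j)
        + (∑ ℓ ∈ Finset.range L, ∑ j, wf ℓ j * resLayer d N W1 b1 Wx Wf b ℓ x j) + bout }

/-- Outgoing weights that read off the linear functional `(u, v) ↦ ∑ a u + ∑ c v` from a layer
storing `u`, `max 0 v` and `max 0 (-v)`. -/
def splitRow {ι κ : Type*} (a : ι → ℝ) (c : κ → ℝ) : ι ⊕ (κ ⊕ κ) → ℝ :=
  Sum.elim a (Sum.elim c (-c))

/-- The layer storing `u` together with the positive and negative parts of `v`. -/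
noncomputable def splitState {ι κ : Type*} (u : ι → ℝ) (v : κ → ℝ) : ι ⊕ (κ ⊕ κ) → ℝ :=
  Sum.elim u (Sum.elim (fun k => max 0 (v k)) (fun k => max 0 (-v k)))

theorem max_zero_sub_max_zero_neg (t : ℝ) : max 0 t - max 0 (-t) = t := by
  rcases le_total 0 t with h | h <;> simp [h]

theorem sum_splitRow_mul_splitState {ι κ : Type*} [Fintype ι] [Fintype κ]
    (a u : ι → ℝ) (c v : κ → ℝ) :
    ∑ t, splitRow a c t * splitState u v t = ∑ i, a i * u i + ∑ k, c k * v k := by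
  simp only [splitRow, splitState, Fintype.sum_sum_type, Sum.elim_inl, Sum.elim_inr,
    Pi.neg_apply, ← Finset.sum_add_distrib]
  congr 1
  refine Finset.sum_congr rfl fun k _ => ?_
  linear_combination c k * max_zero_sub_max_zero_neg (v k)

theorem neg_splitRow {ι κ : Type*} (a : ι → ℝ) (c : κ → ℝ) (t : ι ⊕ (κ ⊕ κ)) :
    splitRow (-a) (-c) t = -splitRow a c t := by
  rcases t with i | k | k <;> simp [splitRow]

/-- The carried values: the input `x` in the slots `some j` and an accumulator in `none`. -/
def carried {d : ℕ} (x : Fin d → ℝ) (A : ℝ) : Option (Fin d) → ℝ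
  | none => A
  | some j => x j

/-- Any recursion on a finite index type of cardinality `M` with ReLU-affine steps is computed by
the hidden layers of a standard network of width `M`. -/
theorem exists_stdNet_of_state {d M : ℕ} {τ : Type*} [Fintype τ] (hM : Fintype.card τ = M)
    (s : ℕ → (Fin d → ℝ) → τ → ℝ)
    (V1 : τ → Fin d → ℝ) (c1 : τ → ℝ) (V : ℕ → τ → τ → ℝ) (c : ℕ → τ → ℝ)
    (h0 : ∀ x t, s 0 x t = max 0 (∑ j, V1 t j * x j + c1 t))
    (hs : ∀ ℓ x t, s (ℓ + 1) x t = max 0 (∑ r, V ℓ t r * s ℓ x r + c ℓ t))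
    (L : ℕ) (w : τ → ℝ) (β : ℝ) :
    (fun x => ∑ t, w t * s (L - 1) x t + β) ∈ stdNet d M L := by
  let e := Fintype.equivFinOfCardEq hM
  refine ⟨fun i => V1 (e.symm i), fun i => c1 (e.symm i),
    fun ℓ i j => V ℓ (e.symm i) (e.symm j), fun ℓ i => c ℓ (e.symm i),
    fun i => w (e.symm i), β, fun x => ?_⟩
  have key : ∀ ℓ i, stdLayer d M (fun i => V1 (e.symm i)) (fun i => c1 (e.symm i))
      (fun ℓ i j => V ℓ (e.symm i) (e.symm j)) (fun ℓ i => c ℓ (e.symm i)) ℓ x i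
      = s ℓ x (e.symm i) := by
    intro ℓ
    induction ℓ with
    | zero => intro i; rw [stdLayer, h0]
    | succ ℓ ih =>
      intro i
      rw [stdLayer, hs]
      simp only [ih]
      rw [Equiv.sum_comp e.symm fun r => V ℓ (e.symm i) r * s ℓ x r]
  simp only [key]
  rw [Equiv.sum_comp e.symm fun t => w t * s (L - 1) x t]

/-- `𝒩̂_L^N ⊆ 𝒩_L^{N+2(d+1)}`. -/
theorem stmt16 (d N L : ℕ) (hd : 1 ≤ d) (hN : 1 ≤ N) (hL : 1 ≤ L) :
    resNet d N L ⊆ stdNet d (N + 2*(d+1)) L := by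
  rintro f ⟨W1, b1, Wx, Wf, b, wx, wf, bout, hf⟩
  let R := resLayer d N W1 b1 Wx Wf b
  let A : ℕ → (Fin d → ℝ) → ℝ := fun ℓ x => ∑ m ∈ Finset.range ℓ, ∑ j, wf m j * R m x j
  let a : ℕ → Option (Fin d) → Fin N → ℝ := fun ℓ k => k.elim (wf ℓ) 0
  let V1 : Option (Fin d) → Fin d → ℝ := fun k => k.elim 0 fun j => Pi.single j 1
  have hV1 : ∀ x k, ∑ j, V1 k j * x j = carried x (A 0 x) k := by
    rintro x (_ | k) <;> simp [V1, carried, A, Pi.single_apply]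
  have hcarry : ∀ ℓ x k, ∑ i, a ℓ k i * R ℓ x i
      + ∑ k', (Pi.single k 1 : Option (Fin d) → ℝ) k' * carried x (A ℓ x) k'
      = carried x (A (ℓ + 1) x) k := by
    rintro ℓ x (_ | k)
    · simp [a, carried, A, Pi.single_apply, Finset.sum_range_succ, add_comm]
    · simp [a, carried, Pi.single_apply]
  have hmem := exists_stdNet_of_state (M := N + 2 * (d + 1))
    (τ := Fin N ⊕ (Option (Fin d) ⊕ Option (Fin d)))
    (by simp; ring)
    (fun ℓ x => splitState (R ℓ x) (carried x (A ℓ x)))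
    (Sum.elim W1 (Sum.elim V1 (-V1)))
    (Sum.elim b1 0)
    (fun ℓ => Sum.elim (fun i => splitRow (Wf ℓ i) (carried (Wx ℓ i) 0))
      (Sum.elim (fun k => splitRow (a ℓ k) (Pi.single k 1))
        (fun k => splitRow (-a ℓ k) (-Pi.single k 1))))
    (fun ℓ => Sum.elim (b ℓ) 0)
    (by
      rintro x (i | k | k)
      · simp [splitState, R, resLayer]
      · simp [splitState, hV1]
      · simp [splitState, hV1])
    (by
      rintro ℓ x (i | k | k)
      · simp only [Sum.elim_inl, sum_splitRow_mul_splitState]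
        simp [splitState, R, resLayer, carried, add_comm]
      · simp only [Sum.elim_inl, Sum.elim_inr, sum_splitRow_mul_splitState, hcarry]
        simp [splitState]
      · simp only [Sum.elim_inr, neg_splitRow, neg_mul, Finset.sum_neg_distrib,
          sum_splitRow_mul_splitState, hcarry]
        simp [splitState])
    L (splitRow (wf (L - 1)) (carried wx 1)) bout
  convert hmem using 1
  funext x
  obtain ⟨n, rfl⟩ : ∃ n, L = n + 1 := ⟨L - 1, by omega⟩
  rw [hf, sum_splitRow_mul_splitState, Finset.sum_range_succ]
  simp only [Nat.add_sub_cancel, Fintype.sum_option, carried, A, R]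
  ring
end

section
/- For every input dimension d ≥ 1, every integer N ≥ 1, and all integers L₁, L₂ ≥ 1, the ResNet-type classes are closed under addition with added depth: if f₁ ∈ 𝒩̂_{L₁}^N and f₂ ∈ 𝒩̂_{L₂}^N, then f₁ + f₂ ∈ 𝒩̂_{L₁+L₂}^N. -/
/-- The sequence `a 0, …, a (m - 1), c, a' 0, a' 1, …`. -/
def spliceSeq {α : Type*} (m : ℕ) (a : ℕ → α) (c : α) (a' : ℕ → α) (k : ℕ) : α :=
  if k < m then a k else if k = m then c else a' (k - (m + 1))

theorem spliceSeq_of_lt {α : Type*} {m k : ℕ} (h : k < m) (a : ℕ → α) (c : α) (a' : ℕ → α) :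
    spliceSeq m a c a' k = a k := by
  simp [spliceSeq, h]

theorem spliceSeq_self {α : Type*} (m : ℕ) (a : ℕ → α) (c : α) (a' : ℕ → α) :
    spliceSeq m a c a' m = c := by
  simp [spliceSeq]

theorem spliceSeq_add {α : Type*} (m k : ℕ) (a : ℕ → α) (c : α) (a' : ℕ → α) :
    spliceSeq m a c a' (m + 1 + k) = a' k := by
  have h₁ : ¬ m + 1 + k < m := by omega
  have h₂ : m + 1 + k ≠ m := by omega
  simp [spliceSeq, h₁, h₂]

section Splice

variable {d N : ℕ} (m : ℕ)
  (W1 W1' : Fin N → Fin d → ℝ) (b1 b1' : Fin N → ℝ)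
  (Wx Wx' : ℕ → Fin N → Fin d → ℝ) (Wf Wf' : ℕ → Fin N → Fin N → ℝ) (b b' : ℕ → Fin N → ℝ)

theorem resLayer_spliceSeq_of_le {k : ℕ} (hk : k ≤ m) (x : Fin d → ℝ) (i : Fin N) :
    resLayer d N W1 b1 (spliceSeq m Wx W1' Wx') (spliceSeq m Wf 0 Wf') (spliceSeq m b b1' b') k x i
      = resLayer d N W1 b1 Wx Wf b k x i := by
  induction k generalizing i with
  | zero => simp only [resLayer]
  | succ k ih =>
    simp only [resLayer, spliceSeq_of_lt (Nat.lt_of_succ_le hk), ih (Nat.le_of_succ_le hk)]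

theorem resLayer_spliceSeq_add (k : ℕ) (x : Fin d → ℝ) (i : Fin N) :
    resLayer d N W1 b1 (spliceSeq m Wx W1' Wx') (spliceSeq m Wf 0 Wf') (spliceSeq m b b1' b')
        (m + 1 + k) x i
      = resLayer d N W1' b1' Wx' Wf' b' k x i := by
  induction k generalizing i with
  | zero => simp [resLayer, spliceSeq_self]
  | succ k ih =>
    rw [← add_assoc]
    simp only [resLayer, spliceSeq_add, ih]

end Splice

/-- Addition: `𝒩̂_{L₁}^N + 𝒩̂_{L₂}^N ⊆ 𝒩̂_{L₁+L₂}^N`. -/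
theorem stmt17 (d N L₁ L₂ : ℕ) (hd : 1 ≤ d) (hN : 1 ≤ N) (hL₁ : 1 ≤ L₁) (hL₂ : 1 ≤ L₂)
    (f₁ f₂ : (Fin d → ℝ) → ℝ) (hf₁ : f₁ ∈ resNet d N L₁) (hf₂ : f₂ ∈ resNet d N L₂) :
    (fun x => f₁ x + f₂ x) ∈ resNet d N (L₁ + L₂) := by
  obtain ⟨m, rfl⟩ : ∃ m, L₁ = m + 1 := ⟨L₁ - 1, by omega⟩
  obtain ⟨W1, b1, Wx, Wf, b, wx, wf, c, h₁⟩ := hf₁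
  obtain ⟨W1', b1', Wx', Wf', b', wx', wf', c', h₂⟩ := hf₂
  refine ⟨W1, b1, spliceSeq m Wx W1' Wx', spliceSeq m Wf 0 Wf', spliceSeq m b b1' b',
    wx + wx', spliceSeq (m + 1) wf (wf' 0) (fun k => wf' (k + 1)), c + c', fun x => ?_⟩
  have hwf : ∀ k, spliceSeq (m + 1) wf (wf' 0) (fun k => wf' (k + 1)) (m + 1 + k) = wf' k := by
    rintro (_ | k)
    · exact spliceSeq_self _ _ _ _
    · rw [show m + 1 + (k + 1) = m + 1 + 1 + k by omega, spliceSeq_add]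
  have hsum : ∑ k ∈ Finset.range (m + 1), ∑ j,
      spliceSeq (m + 1) wf (wf' 0) (fun k => wf' (k + 1)) k j * resLayer d N W1 b1
        (spliceSeq m Wx W1' Wx') (spliceSeq m Wf 0 Wf') (spliceSeq m b b1' b') k x j
      = ∑ k ∈ Finset.range (m + 1), ∑ j, wf k j * resLayer d N W1 b1 Wx Wf b k x j := by
    refine Finset.sum_congr rfl fun k hk => Finset.sum_congr rfl fun j _ => ?_
    have hk' := Finset.mem_range.1 hk
    rw [spliceSeq_of_lt hk', resLayer_spliceSeq_of_le (hk := Nat.le_of_lt_succ hk')]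
  beta_reduce
  rw [h₁, h₂, Finset.sum_range_add _ (m + 1) L₂, hsum]
  simp only [hwf, resLayer_spliceSeq_add, Pi.add_apply, add_mul, Finset.sum_add_distrib]
  ring
end

section
/- Let N ≥ 1 be an integer, let μ_1, …, μ_N be real numbers, and let T_1, …, T_N : ℝ² → ℝ² be affine maps. Then the two-dimensional linear finite element function u_h(x, y) = Σ_{i=1}^N μ_i·φ(T_i(x, y)) can be reproduced globally on ℝ² by a ReLU network with exactly two hidden layers of width 15N: u_h ∈ 𝒩_2^{15N} (with input dimension 2). -/
/-- The 2D linear finite element hat basis function `φ`, supported in `[0,1]²`. -/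
noncomputable def phiFE (x y : ℝ) : ℝ :=
  if 0 ≤ x ∧ x ≤ 1 ∧ 0 ≤ y ∧ y ≤ 1 then
    (1/2) * (hatg (hatg (x/2)) + hatg (hatg (y/2)) - hatg (hatg ((x+y)/2)))
  else 0

/-- A sum of `N` blocks, each a ReLU of an affine combination of `n` ReLU neurons, is realized by
a network with two hidden layers of width `n * N`. -/
lemma sum_max_mem_stdNet {d n : ℕ} [NeZero n] (N : ℕ) (μ : Fin N → ℝ)
    (w : Fin n → Fin N → Fin d → ℝ) (b : Fin n → Fin N → ℝ) (s : Fin n → ℝ) (t : ℝ) :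
    (fun x : Fin d → ℝ =>
      ∑ i, μ i * max 0 (∑ k, s k * max 0 (∑ j, w k i j * x j + b k i) + t))
      ∈ stdNet d (n * N) 2 := by
  let e : Fin (n * N) ≃ Fin n × Fin N := finProdFinEquiv.symm
  refine ⟨fun a => w (e a).1 (e a).2, fun a => b (e a).1 (e a).2,
    fun _ a a' => if (e a').2 = (e a).2 then s (e a').1 else 0, fun _ _ => t,
    fun a => if (e a).1 = 0 then μ (e a).2 else 0, 0, fun x => ?_⟩
  have key (i : Fin N) :
      ∑ a', (if (e a').2 = i then s (e a').1 else 0)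
          * max 0 (∑ j, w (e a').1 (e a').2 j * x j + b (e a').1 (e a').2)
        = ∑ k, s k * max 0 (∑ j, w k i j * x j + b k i) := by
    rw [e.sum_comp fun p : Fin n × Fin N => (if p.2 = i then s p.1 else 0)
        * max 0 (∑ j, w p.1 p.2 j * x j + b p.1 p.2), Fintype.sum_prod_type]
    simp
  simp only [Nat.add_one_sub_one, stdLayer, key, add_zero]
  rw [e.sum_comp fun p : Fin n × Fin N => (if p.1 = 0 then μ p.2 else 0)
      * max 0 (∑ k, s k * max 0 (∑ j, w k p.2 j * x j + b k p.2) + t),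
    Fintype.sum_prod_type_right]
  simp

lemma hatg_eq_max (t : ℝ) : hatg t = max 0 (1 - |2 * t - 1|) := by
  unfold hatg
  grind

lemma hatg_hatg_half {t : ℝ} (h₀ : 0 ≤ t) (h₂ : t ≤ 2) :
    hatg (hatg (t / 2)) = 1 - abs (|2 * t - 2| - 1) := by
  simp only [hatg_eq_max]
  grind

/-- The hexagonal pyramid form of the finite element basis function. -/
lemma phiFE_eq_max (x y : ℝ) :
    phiFE x y = max 0 (1 - (|2 * x - 1| + |2 * y - 1| + |2 * x + 2 * y - 2|) / 2) := by
  unfold phiFE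
  split_ifs with h
  · obtain ⟨hx₀, hx₁, hy₀, hy₁⟩ := h
    rw [hatg_hatg_half hx₀ (by linarith), hatg_hatg_half hy₀ (by linarith),
      hatg_hatg_half (add_nonneg hx₀ hy₀) (by linarith)]
    grind
  · grind

lemma abs_eq_max_zero_add_max_zero_neg (t : ℝ) : |t| = max 0 t + max 0 (-t) := by
  grind

/-- Any 2D linear finite element function `u_h(x,y) = Σ_{i=1}^N μ_i φ(T_i(x,y))`, with
`T_i(z) = A_i z + c_i` affine, belongs to `𝒩_2^{15N}`: it is reproduced globally on `ℝ²`
by a ReLU network with two hidden layers of width `15N`. -/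
theorem stmt19 (N : ℕ) (hN : 1 ≤ N) (μ : Fin N → ℝ)
    (A : Fin N → Fin 2 → Fin 2 → ℝ) (c : Fin N → Fin 2 → ℝ) :
    (fun x : Fin 2 → ℝ =>
      ∑ i, μ i * phiFE (∑ k, A i 0 k * x k + c i 0) (∑ k, A i 1 k * x k + c i 1))
      ∈ stdNet 2 (15 * N) 2 := by
  have block (p q : ℝ) : phiFE p q = max 0 (∑ k, ![-1/2, -1/2, -1/2, -1/2, -1/2, -1/2,
      0, 0, 0, 0, 0, 0, 0, 0, 0] k * max 0 (![2, -2, 0, 0, 2, -2, 0, 0, 0, 0, 0, 0, 0, 0, 0] k * p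
        + ![0, 0, 2, -2, 2, -2, 0, 0, 0, 0, 0, 0, 0, 0, 0] k * q
        + ![-1, 1, -1, 1, -2, 2, 0, 0, 0, 0, 0, 0, 0, 0, 0] k) + 1) := by
    rw [phiFE_eq_max]
    simp only [abs_eq_max_zero_add_max_zero_neg]
    simp [Fin.sum_univ_succ]
    ring_nf
  simp only [block]
  set s : Fin 15 → ℝ := ![-1/2, -1/2, -1/2, -1/2, -1/2, -1/2, 0, 0, 0, 0, 0, 0, 0, 0, 0]
  set α : Fin 15 → ℝ := ![2, -2, 0, 0, 2, -2, 0, 0, 0, 0, 0, 0, 0, 0, 0]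
  set β : Fin 15 → ℝ := ![0, 0, 2, -2, 2, -2, 0, 0, 0, 0, 0, 0, 0, 0, 0]
  set γ : Fin 15 → ℝ := ![-1, 1, -1, 1, -2, 2, 0, 0, 0, 0, 0, 0, 0, 0, 0]
  convert sum_max_mem_stdNet N μ (fun k i j => α k * A i 0 j + β k * A i 1 j)
    (fun k i => α k * c i 0 + β k * c i 1 + γ k) s 1 using 9
  simp only [Fin.sum_univ_two]
  ring_nf
end
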